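/- Let G be a finite p-solvable minimal non-p-supersolvable group, and let P be a Sylow p-subgroup of G containing G^{𝔘_p}. If H is a proper subgroup of G^{𝔘_p} that is c-embedded in G with respect to P, then H ≤ Z(P). -/

import Mathlib

open Subgroup Pointwise

/-- `A < B` is a chief factor of `G`. -/
def IsChiefFactor (G : Type*) [Group G] (A B : Subgroup G) : Prop :=
  A.Normal ∧ B.Normal ∧ A < B ∧
    ∀ N : Subgroup G, N.Normal → A ≤ N → N ≤ B → N = A ∨ N = B

/-- The order of the factor group `B/A`. -/
noncomputable def factorCard {G : Type*} [Group G] (A B : Subgroup G) : ℕ :=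
  Nat.card B / Nat.card A

/-- A finite group is `p`-solvable if every chief factor is a `p`-group or a `p'`-group. -/
def IsPSolvable (p : ℕ) (G : Type*) [Group G] : Prop :=
  ∀ A B : Subgroup G, IsChiefFactor G A B →
    (∃ n : ℕ, factorCard A B = p ^ n) ∨ ¬ p ∣ factorCard A B

/-- A finite group is `p`-supersolvable if it is `p`-solvable and every `p`-chief factor
has order `p`. -/
def IsPSupersolvable (p : ℕ) (G : Type*) [Group G] : Prop :=
  IsPSolvable p G ∧ ∀ A B : Subgroup G, IsChiefFactor G A B →
    p ∣ factorCard A B → factorCard A B = p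

/-- A finite group is `p`-nilpotent if it has a normal Hall `p'`-subgroup. -/
def IsPNilpotent (p : ℕ) (G : Type*) [Group G] : Prop :=
  ∃ H : Subgroup G, H.Normal ∧ ¬ p ∣ Nat.card H ∧ ∃ n : ℕ, H.index = p ^ n

/-- The quotient `G ⧸ N` is `p`-supersolvable (for `N` normal). -/
def QuotientIsPSupersolvable (p : ℕ) {G : Type*} [Group G] (N : Subgroup G) : Prop :=
  ∀ [N.Normal], IsPSupersolvable p (G ⧸ N)

/-- `R` is the `p`-supersolvable residual of `G`: the smallest normal subgroup with
`p`-supersolvable quotient. -/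
def IsPSupersolvableResidual (p : ℕ) {G : Type*} [Group G] (R : Subgroup G) : Prop :=
  R.Normal ∧ QuotientIsPSupersolvable p R ∧
    ∀ N : Subgroup G, N.Normal → QuotientIsPSupersolvable p N → R ≤ N

/-- the center `Z(K)` of a subgroup `K`, as a subgroup of the ambient group. -/
def centerOf {G : Type*} [Group G] (K : Subgroup G) : Subgroup G :=
  Subgroup.centralizer (K : Set G) ⊓ K

/-- `H` is c-embedded in `G` with respect to `K`: there is `B ≤ G` with `G = HB` and
`H ∩ B ≤ Z(K)`. -/
def IsCEmbedded {G : Type*} [Group G] (H K : Subgroup G) : Prop :=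
  ∃ B : Subgroup G, (∀ g : G, ∃ h ∈ H, ∃ b ∈ B, g = h * b) ∧ H ⊓ B ≤ centerOf K

/-- A group is quaternion-free if no section is isomorphic to the quaternion group `Q₈`. -/
def QuaternionFree (G : Type*) [Group G] : Prop :=
  ∀ (H : Subgroup G) (N : Subgroup H) [N.Normal], IsEmpty ((H ⧸ N) ≃* QuaternionGroup 2)

/-- the conjugate `P^x = x⁻¹ P x`. -/
def conjSub {G : Type*} [Group G] (P : Subgroup G) (x : G) : Subgroup G :=
  (MulAut.conj x⁻¹) • P

section

universe u

variable {G : Type*} [Group G]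

lemma factorCard_eq_relIndex [Finite G] {A B : Subgroup G} (h : A ≤ B) :
    factorCard A B = A.relIndex B := by
  have h1 : Nat.card A * A.relIndex B = Nat.card B := by
    rw [← relIndex_bot_left, ← relIndex_bot_left]
    exact relIndex_mul_relIndex ⊥ A B bot_le h
  rw [factorCard, ← h1, Nat.mul_div_cancel_left _ Nat.card_pos]

lemma relIndex_comap_comap_of_surjective {G' : Type*} [Group G'] {f : G →* G'}
    (hf : Function.Surjective f) (A B : Subgroup G') :
    (A.comap f).relIndex (B.comap f) = A.relIndex B := by
  rw [relIndex_comap, map_comap_eq_self_of_surjective hf]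

lemma isChiefFactor_comap_iff {G' : Type*} [Group G'] {f : G →* G'}
    (hf : Function.Surjective f) {A B : Subgroup G'} :
    IsChiefFactor G (A.comap f) (B.comap f) ↔ IsChiefFactor G' A B := by
  have hinj := comap_injective hf
  constructor
  · rintro ⟨hA, hB, hAB, h⟩
    refine ⟨?_, ?_, (comap_lt_comap_of_surjective hf).1 hAB, fun N hN h1 h2 => ?_⟩
    · simpa [map_comap_eq_self_of_surjective hf] using hA.map f hf
    · simpa [map_comap_eq_self_of_surjective hf] using hB.map f hf
    · exact (h (N.comap f) (hN.comap f) (comap_mono h1) (comap_mono h2)).imp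
        (fun e => hinj e) (fun e => hinj e)
  · rintro ⟨hA, hB, hAB, h⟩
    refine ⟨hA.comap f, hB.comap f, (comap_lt_comap_of_surjective hf).2 hAB,
      fun N hN h1 h2 => ?_⟩
    have hker : f.ker ≤ N := (ker_le_comap f A).trans h1
    have hN' : (N.map f).comap f = N := comap_map_eq_self hker
    rw [← hN'] at h1 h2 ⊢
    rw [comap_le_comap_of_surjective hf] at h1 h2
    exact (h _ (hN.map f hf) h1 h2).imp (congrArg _) (congrArg _)

lemma IsPSupersolvable.relIndex_eq [Finite G] {p : ℕ} (h : IsPSupersolvable p G)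
    {A B : Subgroup G} (hAB : IsChiefFactor G A B) (hd : p ∣ A.relIndex B) :
    A.relIndex B = p := by
  have := h.2 A B hAB
  rw [factorCard_eq_relIndex hAB.2.2.1.le] at this
  exact this hd

lemma isPSupersolvable_of_relIndex_eq [Finite G] {p : ℕ}
    (h : ∀ A B : Subgroup G, IsChiefFactor G A B → p ∣ A.relIndex B → A.relIndex B = p) :
    IsPSupersolvable p G := by
  have h' : ∀ A B : Subgroup G, IsChiefFactor G A B → p ∣ factorCard A B →
      factorCard A B = p := fun A B hAB => by
    rw [factorCard_eq_relIndex hAB.2.2.1.le]; exact h A B hAB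
  refine ⟨fun A B hAB => ?_, h'⟩
  by_cases hd : p ∣ factorCard A B
  · exact Or.inl ⟨1, by rw [pow_one]; exact h' A B hAB hd⟩
  · exact Or.inr hd

lemma quotientIsPSupersolvable_iff [Finite G] {p : ℕ} {N : Subgroup G} [hN : N.Normal] :
    QuotientIsPSupersolvable p N ↔ ∀ A B : Subgroup G, IsChiefFactor G A B → N ≤ A →
      p ∣ A.relIndex B → A.relIndex B = p := by
  have hs := QuotientGroup.mk'_surjective N
  constructor
  · intro h A B hAB hNA hd
    have e : ∀ C : Subgroup G, N ≤ C → (C.map (QuotientGroup.mk' N)).comap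
        (QuotientGroup.mk' N) = C := fun C hC =>
      comap_map_eq_self (by rwa [QuotientGroup.ker_mk'])
    have eA := e A hNA
    have eB := e B (hNA.trans hAB.2.2.1.le)
    rw [← eA, ← eB] at hAB hd ⊢
    rw [relIndex_comap_comap_of_surjective hs] at hd ⊢
    exact h.relIndex_eq ((isChiefFactor_comap_iff hs).1 hAB) hd
  · intro h _
    refine isPSupersolvable_of_relIndex_eq fun A B hAB hd => ?_
    rw [← relIndex_comap_comap_of_surjective hs] at hd ⊢
    refine h _ _ ((isChiefFactor_comap_iff hs).2 hAB) ?_ hd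
    exact (QuotientGroup.ker_mk' N).symm.le.trans (ker_le_comap _ A)

lemma sup_inf_eq_of_le_of_normal {A B R : Subgroup G} [R.Normal] (h : A ≤ B) :
    (A ⊔ R) ⊓ B = A ⊔ R ⊓ B := by
  refine le_antisymm ?_ (le_inf (sup_le_sup_left inf_le_left _) (sup_le h inf_le_right))
  rintro x ⟨hx, hxB⟩
  obtain ⟨a, ha, r, hr, rfl⟩ := mem_sup_of_normal_right.1 hx
  exact mul_mem_sup ha ⟨hr, (B.mul_mem_cancel_left (h ha)).1 hxB⟩

/-- Extending a `p`-supersolvable quotient by a normal subgroup of order `p` gives a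
`p`-supersolvable quotient. -/
lemma quotientIsPSupersolvable_of_relIndex_eq_prime [Finite G] {p : ℕ} {N R : Subgroup G}
    [N.Normal] [R.Normal] (hNR : N ≤ R)
    (hR : QuotientIsPSupersolvable p R) (hi : N.relIndex R = p) :
    QuotientIsPSupersolvable p N := by
  rw [quotientIsPSupersolvable_iff] at hR ⊢
  intro A B hAB hNA hd
  obtain ⟨hA, hB, hlt, hmin⟩ := hAB
  have hle := hlt.le
  rcases hmin (A ⊔ R ⊓ B) inferInstance le_sup_left (sup_le hle inf_le_right) with hC | hC
  · have hmod : (A ⊔ R) ⊓ B = A := by rw [sup_inf_eq_of_le_of_normal hle, hC]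
    have hsup : B ⊔ (A ⊔ R) = B ⊔ R := by rw [← sup_assoc, sup_eq_left.2 hle]
    have hidx : (A ⊔ R).relIndex (B ⊔ R) = A.relIndex B := by
      rw [← hsup, relIndex_sup_right, ← inf_relIndex_right, hmod]
    rw [← hidx] at hd ⊢
    refine hR _ _ ⟨inferInstance, inferInstance, ?_, fun M hM h1 h2 => ?_⟩ le_sup_right hd
    · refine lt_of_le_of_ne (sup_le_sup_right hle R) fun e => ?_
      rw [e, inf_eq_right.2 le_sup_left] at hmod
      exact hlt.ne hmod.symm
    · have hRM : R ≤ M := le_sup_right.trans h1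
      have hM' : M ⊓ B ⊔ R = M := by
        rw [sup_comm, inf_comm]
        refine le_antisymm (sup_le hRM inf_le_right) fun x hx => ?_
        obtain ⟨b, hb, r, hr, rfl⟩ := mem_sup_of_normal_right.1 (h2 hx)
        rw [sup_comm]
        exact mul_mem_sup ⟨hb, (M.mul_mem_cancel_right (hRM hr)).1 hx⟩ hr
      refine (hmin (M ⊓ B) inferInstance (le_inf (le_sup_left.trans h1) hle) inf_le_right).imp
        (fun e => ?_) (fun e => ?_) <;> rw [← hM', e]
  · have h1 : A.relIndex B = (A ⊓ (R ⊓ B)).relIndex (R ⊓ B) := by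
      conv_lhs => rw [← hC, relIndex_sup_left]
      rw [inf_relIndex_right]
    have h2 : N ≤ A ⊓ (R ⊓ B) := le_inf hNA (le_inf hNR (hNA.trans hle))
    have h3 : A.relIndex B ∣ p := by
      rw [h1, ← hi, ← relIndex_mul_relIndex N _ R h2 (inf_le_right.trans inf_le_left),
        ← relIndex_mul_relIndex _ (R ⊓ B) R inf_le_right inf_le_left]
      exact Dvd.dvd.mul_left (dvd_mul_right _ _) _
    exact Nat.dvd_antisymm h3 hd

lemma exists_isChiefFactor_above [Finite G] {K : Subgroup G} (hK : K.Normal) (h : K ≠ ⊤) :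
    ∃ A, IsChiefFactor G K A := by
  obtain ⟨A, ⟨hA, hKA⟩, hmin⟩ := exists_minimal_of_wellFoundedLT
    (fun A : Subgroup G => A.Normal ∧ K < A) ⟨⊤, inferInstance, lt_top_iff_ne_top.2 h⟩
  refine ⟨A, hK, hA, hKA, fun N hN h1 h2 => ?_⟩
  rcases h1.eq_or_lt with e | hlt
  · exact Or.inl e.symm
  · exact Or.inr (le_antisymm h2 (hmin ⟨hN, hlt⟩ h2))

lemma exists_isChiefFactor_below [Finite G] {K T : Subgroup G} (hK : K.Normal) (hT : T.Normal)
    (h : K < T) : ∃ A, K ≤ A ∧ IsChiefFactor G A T := by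
  obtain ⟨A, ⟨hA, hKA, hAT⟩, hmax⟩ := exists_maximal_of_wellFoundedGT
    (fun A : Subgroup G => A.Normal ∧ K ≤ A ∧ A < T) ⟨K, hK, le_rfl, h⟩
  refine ⟨A, hKA, hA, hT, hAT, fun N hN h1 h2 => ?_⟩
  rcases h2.eq_or_lt with e | hlt
  · exact Or.inr e
  · exact Or.inl (le_antisymm (hmax ⟨hN, hKA.trans h1, hlt⟩ h1) h1)

lemma IsPGroup.index_eq_of_isCoatom [Finite G] {p : ℕ} [Fact p.Prime] (hG : IsPGroup p G)
    {L : Subgroup G} (hL : IsCoatom L) : L.index = p := by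
  obtain ⟨n, hn⟩ := IsPGroup.iff_card.1 (hG.to_subgroup L)
  obtain ⟨k, hk⟩ := hG.index L
  have hk0 : k ≠ 0 := by
    rintro rfl
    exact hL.1 (index_eq_one.1 (by simpa using hk))
  have hd : p ^ (n + 1) ∣ Nat.card G := by
    rw [← L.card_mul_index, hn, hk, ← pow_add]
    exact pow_dvd_pow _ (by omega)
  obtain ⟨K, hK, hLK⟩ := Sylow.exists_subgroup_card_pow_succ hd hn
  have hKtop : K = ⊤ := by
    refine hL.2 K (lt_of_le_of_ne hLK ?_)
    rintro rfl
    have := Nat.pow_right_injective (Fact.out : p.Prime).two_le (hn.symm.trans hK)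
    omega
  have hm := L.card_mul_index
  rw [← card_top (G := G), ← hKtop, hK, hn, pow_succ] at hm
  exact Nat.eq_of_mul_eq_mul_left (pow_pos (Fact.out : p.Prime).pos n) hm

lemma IsPGroup.normal_of_isCoatom [Finite G] {p : ℕ} [Fact p.Prime] (hG : IsPGroup p G)
    {L : Subgroup G} (hL : IsCoatom L) : L.Normal := by
  have : Group.IsNilpotent G := hG.isNilpotent
  exact NormalizerCondition.normal_of_coatom L Group.normalizerCondition_of_isNilpotent hL

lemma IsPGroup.pow_mem_frattini [Finite G] {p : ℕ} [Fact p.Prime] (hG : IsPGroup p G)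
    (x : G) : x ^ p ∈ frattini G := by
  simp only [frattini, Order.radical, mem_iInf]
  intro L hL
  have := hG.normal_of_isCoatom hL
  have h := hG.index_eq_of_isCoatom hL
  exact h ▸ L.pow_index_mem x

lemma IsPGroup.commutator_mem_frattini [Finite G] {p : ℕ} [Fact p.Prime] (hG : IsPGroup p G)
    (x y : G) : x * y * x⁻¹ * y⁻¹ ∈ frattini G := by
  simp only [frattini, Order.radical, mem_iInf]
  intro L hL
  have := hG.normal_of_isCoatom hL
  have h : Nat.card (G ⧸ L) = p := hG.index_eq_of_isCoatom hL
  have hc : IsCyclic (G ⧸ L) := isCyclic_of_prime_card h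
  rw [← QuotientGroup.eq_one_iff]
  have hxy : (x : G ⧸ L) * y = y * x := (IsCyclic.isMulCommutative (α := G ⧸ L)).is_comm.comm _ _
  simp [hxy]

/-- The complement lemma for representations acting trivially on the one-dimensional submodule. -/
lemma exists_isCompl_of_trivial [Finite G] {p : ℕ} [Fact p.Prime] {V : Type*} [AddCommGroup V]
    [Module (ZMod p) V] [Finite V] (ρ : Representation (ZMod p) G V)
    (hchief : ∀ A : Subgroup G, IsChiefFactor G ρ.ker A → p ∣ ρ.ker.relIndex A →
      ρ.ker.relIndex A = p)
    (T : Submodule (ZMod p) V) (hT : Module.finrank (ZMod p) T = 1) (hTtop : T ≠ ⊤)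
    (htriv : ∀ g, ∀ t ∈ T, ρ g t = t)
    (hirr : ∀ W : Submodule (ZMod p) V, (∀ g, ∀ v ∈ W, ρ g v ∈ W) → T ≤ W → W = T ∨ W = ⊤)
    (hV : Module.finrank (ZMod p) V ≠ 2) :
    ∃ N : Submodule (ZMod p) V, (∀ g, ∀ v ∈ N, ρ g v ∈ N) ∧ IsCompl N T := by
  have hlt : 1 < Module.finrank (ZMod p) V := hT ▸ Submodule.finrank_lt hTtop
  have hmul : ∀ g h v, ρ (g * h) v = ρ g (ρ h v) := fun g h v => by simp
  have hK : ρ.ker ≠ ⊤ := by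
    intro hK
    obtain ⟨v, -, hv⟩ := SetLike.exists_of_lt (lt_top_iff_ne_top.2 hTtop)
    have h1 : ∀ g, ρ g = 1 := fun g => by
      have : g ∈ ρ.ker := hK ▸ mem_top g
      exact this
    rcases hirr (T ⊔ Submodule.span (ZMod p) {v}) (fun g w hw => by simpa [h1] using hw)
      le_sup_left with e | e
    · exact hv (e ▸ Submodule.mem_sup_right (Submodule.mem_span_singleton_self v))
    · have h2 := Submodule.finrank_add_le_finrank_add_finrank T (Submodule.span (ZMod p) {v})
      have h3 := finrank_span_le_card (R := ZMod p) ({v} : Set V)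
      rw [e, finrank_top] at h2
      simp at h3
      omega
  obtain ⟨A, hA⟩ := exists_isChiefFactor_above (MonoidHom.normal_ker ρ) hK
  have hAn := hA.2.1
  have hconj : ∀ g, ∀ a ∈ A, g⁻¹ * a * g ∈ A := fun g a ha => by
    simpa using hAn.conj_mem a ha g⁻¹
  -- the fixed points of `A`
  have hF : ∀ v, (∀ a ∈ A, ρ a v = v) → v ∈ T := by
    let F : Submodule (ZMod p) V := ⨅ a : A, LinearMap.eqLocus (ρ a) LinearMap.id
    have memF : ∀ v, v ∈ F ↔ ∀ a ∈ A, ρ a v = v := fun v => by simp [F]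
    have hFinv : ∀ g, ∀ v ∈ F, ρ g v ∈ F := fun g v hv => by
      rw [memF] at hv ⊢
      intro a ha
      have h1 := hv _ (hconj g a ha)
      rw [← hmul, show a * g = g * (g⁻¹ * a * g) by group, hmul, h1]
    rcases hirr F hFinv (fun t ht => (memF t).2 fun a _ => htriv a t ht) with e | e
    · exact fun v hv => e ▸ (memF v).2 hv
    · exfalso
      refine hA.2.2.1.not_ge fun a ha => ?_
      have : ρ a = 1 := by
        ext v
        exact (memF v).1 (e ▸ Submodule.mem_top) a ha
      exact this
  have hcard := relIndex_ker ρ.toHomUnits (K := A)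
  have hker : ρ.toHomUnits.ker = ρ.ker := by
    ext g
    simp [MonoidHom.mem_ker]
  rw [hker] at hcard
  have hfin : ((A.map ρ.toHomUnits : Subgroup _) : Set (V →ₗ[ZMod p] V)ˣ).Finite :=
    (A : Set G).toFinite.image _
  have hu : ∀ g, ((ρ.toHomUnits g : (V →ₗ[ZMod p] V)ˣ) : V →ₗ[ZMod p] V) = ρ g := fun g => rfl
  by_cases hd : p ∣ ρ.ker.relIndex A
  · exfalso
    have hQ := hchief A hA hd
    rw [hQ] at hcard
    obtain ⟨a, haA, haK⟩ := SetLike.exists_of_lt hA.2.2.1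
    set δ : Module.End (ZMod p) V := ρ a - 1 with hδ
    have hpow : ∀ b ∈ A, ∃ n : ℕ, ρ b = ρ a ^ n := by
      intro b hb
      let a' : A.map ρ.toHomUnits := ⟨_, mem_map_of_mem _ haA⟩
      let b' : A.map ρ.toHomUnits := ⟨_, mem_map_of_mem _ hb⟩
      have hne : a' ≠ 1 := by
        intro e
        apply haK
        have := congrArg (fun x : A.map ρ.toHomUnits => ((x : (V →ₗ[ZMod p] V)ˣ) :
          V →ₗ[ZMod p] V)) e
        exact this
      obtain ⟨n, hn⟩ := mem_powers_of_prime_card (g := a') (g' := b') hcard.symm hne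
      refine ⟨n, ?_⟩
      have := congrArg (fun x : A.map ρ.toHomUnits => ((x : (V →ₗ[ZMod p] V)ˣ) :
          V →ₗ[ZMod p] V)) hn
      simpa [a', b', hu] using this.symm
    have hpp : ρ a ^ p = 1 := by
      let a' : A.map ρ.toHomUnits := ⟨_, mem_map_of_mem _ haA⟩
      have h1 := pow_card_eq_one' (x := a')
      rw [← hcard] at h1
      have := congrArg (fun x : A.map ρ.toHomUnits => ((x : (V →ₗ[ZMod p] V)ˣ) :
          V →ₗ[ZMod p] V)) h1
      simpa [a', hu] using this
    have hmemδ : ∀ v, δ v = ρ a v - v := fun v => rfl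
    have hkerT : LinearMap.ker δ = T := by
      refine le_antisymm (fun v hv => hF v fun b hb => ?_) (fun t ht => ?_)
      · obtain ⟨n, hn⟩ := hpow b hb
        have hav : ρ a v = v := sub_eq_zero.1 hv
        rw [hn]
        clear hn
        induction n with
        | zero => simp
        | succ n ih => rw [pow_succ, Module.End.mul_apply, hav, ih]
      · rw [LinearMap.mem_ker, hmemδ, htriv a t ht, sub_self]
    have hnil : δ ^ p = 0 := by
      have : CharP (Module.End (ZMod p) V) p := by
        have : Nontrivial V := Module.nontrivial_of_finrank_pos (R := ZMod p) (by omega)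
        exact charP_of_injective_algebraMap
          (algebraMap (ZMod p) (Module.End (ZMod p) V)).injective p
      rw [hδ, sub_pow_char_of_commute p (Commute.one_right _), hpp, one_pow, sub_self]
    let F : Submodule (ZMod p) V := ⨅ b : A, T.comap (ρ b - LinearMap.id)
    have memF : ∀ v, v ∈ F ↔ ∀ b ∈ A, ρ b v - v ∈ T := fun v => by simp [F]
    have memF' : ∀ v, v ∈ F ↔ δ v ∈ T := by
      intro v
      rw [memF]
      refine ⟨fun h => h a haA, fun h b hb => ?_⟩
      obtain ⟨n, hn⟩ := hpow b hb
      rw [hn]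
      clear hn
      induction n with
      | zero => simp
      | succ n ih =>
        rw [pow_succ', Module.End.mul_apply]
        have h1 : ρ a ((ρ a ^ n) v) - v = ρ a ((ρ a ^ n) v - v) + δ v := by
          rw [map_sub, hmemδ]; abel
        rw [h1, htriv a _ ih]
        exact T.add_mem ih h
    have hFtop : F = ⊤ := by
      refine (hirr F (fun g v hv => ?_) fun t ht => ?_).resolve_left fun e => ?_
      · rw [memF] at hv ⊢
        intro b hb
        have h1 := hv _ (hconj g b hb)
        have h2 : ρ b (ρ g v) - ρ g v = ρ g (ρ (g⁻¹ * b * g) v - v) := by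
          rw [map_sub, ← hmul, ← hmul]
          congr 3
          group
        rw [h2, htriv g _ h1]
        exact h1
      · rw [memF']
        rw [← hkerT, LinearMap.mem_ker] at ht
        rw [ht]; exact T.zero_mem
      · have h1 : ∀ n v, (δ ^ n) v ∈ T → v ∈ F := by
          intro n
          induction n with
          | zero => intro v hv; rw [e]; simpa using hv
          | succ n ih =>
            intro v hv
            rw [pow_succ, Module.End.mul_apply] at hv
            rw [memF', ← e]
            exact ih _ hv
        exact hTtop (e ▸ eq_top_iff.2 fun v _ => h1 p v (by rw [hnil]; exact T.zero_mem))
    have hr := δ.finrank_range_add_finrank_ker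
    have hrange : LinearMap.range δ ≤ T := by
      rintro _ ⟨v, rfl⟩
      exact (memF' v).1 (hFtop ▸ Submodule.mem_top)
    have := Submodule.finrank_mono hrange
    rw [hkerT] at hr
    omega
  · classical
    let S : Finset (V →ₗ[ZMod p] V)ˣ := hfin.toFinset
    have memS : ∀ f, f ∈ S ↔ f ∈ A.map ρ.toHomUnits := fun f => by simp [S]
    have hS : (S.card : ZMod p) ≠ 0 := by
      rw [Ne, ZMod.natCast_eq_zero_iff]
      convert hd
      rw [hcard, ← Set.ncard_eq_toFinset_card _ hfin]
      rfl
    let ν : V →ₗ[ZMod p] V := ∑ f ∈ S, (f : V →ₗ[ZMod p] V)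
    have hν : ∀ v, ν v = ∑ f ∈ S, (f : V →ₗ[ZMod p] V) v := fun v => by
      simp [ν, LinearMap.sum_apply]
    have hνT : ∀ t ∈ T, ν t = (S.card : ZMod p) • t := by
      intro t ht
      rw [hν, Finset.sum_congr rfl (g := fun _ => t), Finset.sum_const, Nat.cast_smul_eq_nsmul]
      intro f hf
      obtain ⟨a, -, rfl⟩ := (memS f).1 hf
      exact htriv a t ht
    have hνmem : ∀ v, ν v ∈ T := by
      intro v
      refine hF _ fun a ha => ?_
      rw [hν, map_sum]
      refine Finset.sum_bij (fun f _ => ρ.toHomUnits a * f) (fun f hf => ?_)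
        (fun f _ f' _ h => mul_left_cancel h) (fun f hf => ?_) (fun f _ => rfl)
      · rw [memS] at hf ⊢
        exact mul_mem (mem_map_of_mem _ ha) hf
      · refine ⟨(ρ.toHomUnits a)⁻¹ * f, ?_, by simp⟩
        rw [memS] at hf ⊢
        exact mul_mem (inv_mem (mem_map_of_mem _ ha)) hf
    have hνcomm : ∀ g v, ν (ρ g v) = ρ g (ν v) := by
      intro g v
      have hconj' : ∀ g, ∀ f ∈ S, ρ.toHomUnits g * f * (ρ.toHomUnits g)⁻¹ ∈ S := by
        intro g f hf
        obtain ⟨a, ha, rfl⟩ := (memS f).1 hf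
        rw [memS, ← map_inv, ← map_mul, ← map_mul]
        exact mem_map_of_mem _ (hAn.conj_mem a ha g)
      rw [hν, hν, map_sum]
      symm
      refine Finset.sum_bij (fun f _ => ρ.toHomUnits g * f * (ρ.toHomUnits g)⁻¹)
        (fun f hf => hconj' g f hf) (fun f _ f' _ h => by simpa using h) (fun f hf => ?_)
        (fun f _ => ?_)
      · refine ⟨ρ.toHomUnits g⁻¹ * f * (ρ.toHomUnits g⁻¹)⁻¹, hconj' _ f hf, ?_⟩
        rw [map_inv]; group
      · rw [← hu, ← Module.End.mul_apply, ← Module.End.mul_apply, ← Units.val_mul,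
          ← Units.val_mul]
        simp
    refine ⟨LinearMap.ker ν, fun g v hv => ?_, ?_, ?_⟩
    · rw [LinearMap.mem_ker] at hv ⊢
      rw [hνcomm, hv, map_zero]
    · rw [Submodule.disjoint_def]
      intro t hk ht
      rw [LinearMap.mem_ker, hνT t ht] at hk
      exact (smul_eq_zero.1 hk).resolve_left hS
    · rw [codisjoint_iff, eq_top_iff]
      intro v _
      rw [Submodule.mem_sup]
      refine ⟨v - (S.card : ZMod p)⁻¹ • ν v, ?_, (S.card : ZMod p)⁻¹ • ν v,
        T.smul_mem _ (hνmem v), by simp⟩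
      rw [LinearMap.mem_ker, map_sub, map_smul, hνT _ (hνmem v), smul_smul,
        inv_mul_cancel₀ hS, one_smul, sub_self]

/-- Let `T` be an invariant line of a representation over `ZMod p` with irreducible quotient of
dimension different from one. If every chief factor of `G` above `S`, where `S` acts trivially,
of order divisible by `p` has order `p`, then `T` has an invariant complement. -/
lemma exists_isCompl_of_finrank_eq_one [Finite G] {p : ℕ} [Fact p.Prime] {V : Type*}
    [AddCommGroup V] [Module (ZMod p) V] [Finite V] (ρ : Representation (ZMod p) G V)
    (S : Subgroup G) (hS : ∀ s ∈ S, ρ s = 1)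
    (hchief : ∀ A B : Subgroup G, IsChiefFactor G A B → S ≤ A → p ∣ A.relIndex B →
      A.relIndex B = p)
    (T : Submodule (ZMod p) V) (hT : Module.finrank (ZMod p) T = 1) (hTtop : T ≠ ⊤)
    (hinv : ∀ g, ∀ t ∈ T, ρ g t ∈ T)
    (hirr : ∀ W : Submodule (ZMod p) V, (∀ g, ∀ v ∈ W, ρ g v ∈ W) → T ≤ W → W = T ∨ W = ⊤)
    (hV : Module.finrank (ZMod p) V ≠ 2) :
    ∃ N : Submodule (ZMod p) V, (∀ g, ∀ v ∈ N, ρ g v ∈ N) ∧ IsCompl N T := by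
  obtain ⟨⟨t, htT⟩, ht0, hspan⟩ := finrank_eq_one_iff'.1 hT
  have ht0 : t ≠ 0 := fun e => ht0 (Subtype.ext e)
  have hspan : ∀ w ∈ T, ∃ c : ZMod p, c • t = w := fun w hw => by
    obtain ⟨c, hc⟩ := hspan ⟨w, hw⟩
    exact ⟨c, congrArg Subtype.val hc⟩
  choose χ hχ using fun g => hspan _ (hinv g t htT)
  have hinj : ∀ c d : ZMod p, c • t = d • t → c = d := fun c d h => smul_left_injective _ ht0 h
  have hχ1 : ∀ g, ρ g = 1 → χ g = 1 := fun g hg => hinj _ _ (by rw [hχ, hg]; simp)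
  have hχmul : ∀ g h, χ (g * h) = χ g * χ h := fun g h => hinj _ _ (by
    rw [hχ, map_mul, Module.End.mul_apply, ← hχ h, map_smul, ← hχ g, smul_smul, mul_comm])
  have hχ0 : ∀ g, χ g ≠ 0 := fun g h => by
    have h1 := hχmul g g⁻¹
    rw [mul_inv_cancel, hχ1 1 (map_one ρ), h, zero_mul] at h1
    exact one_ne_zero h1
  have hχT : ∀ g, ∀ w ∈ T, ρ g w = χ g • w := fun g w hw => by
    obtain ⟨c, rfl⟩ := hspan w hw
    rw [map_smul, ← hχ, smul_comm]
  let σ : Representation (ZMod p) G V :=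
    { toFun := fun g => (χ g)⁻¹ • ρ g
      map_one' := by rw [hχ1 1 (map_one ρ), map_one]; simp
      map_mul' := fun g h => by
        rw [hχmul, map_mul, smul_mul_smul_comm, mul_inv] }
  have hσ : ∀ g v, σ g v = (χ g)⁻¹ • ρ g v := fun g v => rfl
  have hiff : ∀ W : Submodule (ZMod p) V, (∀ g, ∀ v ∈ W, σ g v ∈ W) ↔
      ∀ g, ∀ v ∈ W, ρ g v ∈ W := fun W =>
    forall₃_congr fun g v _ => by
      rw [hσ, Submodule.smul_mem_iff _ (inv_ne_zero (hχ0 g))]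
  have hSσ : S ≤ σ.ker := fun s hs => by
    have : σ s = 1 := by
      ext v
      rw [hσ, hχ1 s (hS s hs), hS s hs, inv_one, one_smul]
    exact this
  obtain ⟨N, hN, hc⟩ := exists_isCompl_of_trivial σ (fun A hA => hchief _ A hA hSσ) T hT hTtop
    (fun g w hw => by rw [hσ, hχT g w hw, smul_smul, inv_mul_cancel₀ (hχ0 g), one_smul])
    (fun W hW => hirr W ((hiff W).1 hW)) hV
  exact ⟨N, (hiff N).1 hN, hc⟩

/-- The conjugation action of `G` on a section `R / S`. -/
lemma exists_conj_action_on_section {G : Type u} [Group G] [Finite G] (S R : Subgroup G) [hSn : S.Normal] [R.Normal] :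
    ∃ (Q : Type u) (_ : Group Q) (_ : Finite Q) (q : R →* Q) (φ : G → Q →* Q),
      Function.Surjective q ∧ q.ker = S.subgroupOf R ∧
      ∀ g x, φ g (q x) = q (MulAut.conjNormal g x) := by
  have hle : ∀ g : G, S.subgroupOf R ≤
      (S.subgroupOf R).comap (MulAut.conjNormal g : MulAut R).toMonoidHom := fun g x hx => by
    simpa [mem_subgroupOf] using hSn.conj_mem _ (mem_subgroupOf.1 hx) g
  refine ⟨R ⧸ S.subgroupOf R, inferInstance, inferInstance,
    QuotientGroup.mk' (S.subgroupOf R),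
    fun g => QuotientGroup.map _ _ (MulAut.conjNormal g : MulAut R).toMonoidHom (hle g),
    QuotientGroup.mk'_surjective _, QuotientGroup.ker_mk' _, fun g x => ?_⟩
  exact QuotientGroup.map_mk' _ _ _ (hle g) x

/-- An action of `G` by endomorphisms of an abelian group of exponent dividing `p`, induced by
the conjugation action on `R`, is a representation over `ZMod p`. -/
lemma exists_representation_of_conj_action {p : ℕ} {R : Subgroup G} [R.Normal] {V : Type*}
    [AddCommGroup V] [Module (ZMod p) V] {q : R → V} (hq : Function.Surjective q)
    (φ : G → V →+ V) (hφ : ∀ g x, φ g (q x) = q (MulAut.conjNormal g x)) :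
    ∃ ρ : Representation (ZMod p) G V, ∀ g x, ρ g (q x) = q (MulAut.conjNormal g x) :=
  ⟨{
      toFun := fun g => (φ g).toZModLinearMap p
      map_one' := LinearMap.ext fun v => by
        obtain ⟨x, rfl⟩ := hq v
        change φ 1 (q x) = q x
        rw [hφ, map_one, MulAut.one_apply]
      map_mul' := fun g h => LinearMap.ext fun v => by
        obtain ⟨x, rfl⟩ := hq v
        change φ (g * h) (q x) = φ g (φ h (q x))
        rw [hφ, hφ, hφ, map_mul, MulAut.mul_apply] }, hφ⟩

/-- The representation of `G` on an elementary abelian section `R / S` by conjugation. -/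
lemma exists_representation_of_section {G : Type u} [Group G] [Finite G] {p : ℕ}
    {S R : Subgroup G} [S.Normal] [R.Normal]
    (hcomm : ∀ x ∈ R, ∀ y ∈ R, x * y * x⁻¹ * y⁻¹ ∈ S) (hpow : ∀ x ∈ R, x ^ p ∈ S) :
    ∃ (V : Type u) (_ : AddCommGroup V) (_ : Module (ZMod p) V) (_ : Finite V)
      (q : R →* Multiplicative V) (ρ : Representation (ZMod p) G V), Function.Surjective q ∧
      q.ker = S.subgroupOf R ∧
      ∀ g x, ρ g (q x).toAdd = (q (MulAut.conjNormal g x)).toAdd := by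
  obtain ⟨Q, hQ, hfin, q, φ, hq, hker, hφ⟩ := exists_conj_action_on_section S R
  have hone : ∀ x : R, q x = 1 ↔ (x : G) ∈ S := fun x => by
    rw [← mem_subgroupOf, ← hker, MonoidHom.mem_ker]
  have hmul : ∀ a b : Q, a * b = b * a := fun a b => by
    obtain ⟨x, rfl⟩ := hq a
    obtain ⟨y, rfl⟩ := hq b
    have h := (hone (x * y * x⁻¹ * y⁻¹)).2 (hcomm x x.2 y y.2)
    rw [map_mul, map_mul, map_mul, map_inv, map_inv, mul_inv_eq_one, mul_inv_eq_iff_eq_mul] at h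
    exact h
  have hexp : ∀ a : Q, a ^ p = 1 := fun a => by
    obtain ⟨x, rfl⟩ := hq a
    rw [← map_pow]
    exact (hone (x ^ p)).2 (hpow x x.2)
  obtain ⟨C, rfl⟩ : ∃ C : CommGroup Q, hQ = C.toGroup :=
    ⟨{ hQ with mul_comm := hmul }, rfl⟩
  let hmod : Module (ZMod p) (Additive Q) := AddCommGroup.zmodModule hexp
  obtain ⟨ρ, hρ⟩ := exists_representation_of_conj_action (p := p) (V := Additive Q) (q := q) hq
    (fun g => MonoidHom.toAdditive (φ g)) hφ
  exact ⟨Additive Q, Additive.addCommGroup, hmod, hfin, q, ρ, hq, hker, hρ⟩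

/-- A noncyclic chief factor `R / T` splits off from an elementary abelian section `R / S` with
`T / S` of order `p`, provided that `G ⧸ R` is `p`-supersolvable. -/
lemma exists_normal_relIndex_eq_prime [Finite G] {p : ℕ} [hp : Fact p.Prime]
    {S T R : Subgroup G} [S.Normal] (hST : S ≤ T) (hTR : IsChiefFactor G T R)
    (hcomm : ∀ x ∈ R, ∀ y ∈ R, x * y * x⁻¹ * y⁻¹ ∈ S) (hpow : ∀ x ∈ R, x ^ p ∈ S)
    (hS : S.relIndex T = p) (hT : T.relIndex R ≠ p) (hR : QuotientIsPSupersolvable p R) :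
    ∃ N : Subgroup G, N.Normal ∧ N ≤ R ∧ N.relIndex R = p := by
  obtain ⟨hTn, hRn, hlt, hmin⟩ := hTR
  obtain ⟨V, _, _, _, q, ρ, hq, hker, hρ⟩ := exists_representation_of_section hcomm hpow
  rw [quotientIsPSupersolvable_iff] at hR
  let pull : Submodule (ZMod p) V → Subgroup G := fun W =>
    ((AddSubgroup.toSubgroup W.toAddSubgroup).comap q).map R.subtype
  have mem_pull : ∀ W (x : R), (x : G) ∈ pull W ↔ (q x).toAdd ∈ W := fun W x => by
    simp [pull]
  have pull_le : ∀ W, pull W ≤ R := fun W => map_subtype_le _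
  have q_eq : ∀ x : R, (q x).toAdd = 0 ↔ (x : G) ∈ S := fun x => by
    rw [← mem_subgroupOf, ← hker]; rfl
  have le_pull : ∀ W, S ≤ pull W := fun W x hx => by
    have h := (q_eq ⟨x, (hST.trans hlt.le) hx⟩).2 hx
    refine (mem_pull W ⟨x, (hST.trans hlt.le) hx⟩).2 ?_
    rw [h]
    exact W.zero_mem
  have card_pull : ∀ W, S.relIndex (pull W) = Nat.card W := fun W => by
    rw [← relIndex_subgroupOf (pull_le W), ← hker, relIndex_ker]
    have : ((pull W).subgroupOf R).map q = AddSubgroup.toSubgroup W.toAddSubgroup := by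
      rw [← map_comap_eq_self_of_surjective hq (AddSubgroup.toSubgroup W.toAddSubgroup)]
      congr 1
      exact comap_map_eq_self_of_injective R.subtype_injective _
    rw [this]
    rfl
  have pull_normal : ∀ W, (∀ g, ∀ v ∈ W, ρ g v ∈ W) → (pull W).Normal := fun W hW =>
    ⟨fun x hx g => by
      have h1 : (q ⟨x, pull_le W hx⟩).toAdd ∈ W := (mem_pull W _).1 hx
      have h2 := hW g _ h1
      rw [hρ, ← mem_pull] at h2
      exact h2⟩
  have pull_inj : ∀ W W', pull W = pull W' → W = W' := fun W W' h => by
    ext v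
    obtain ⟨x, hx⟩ := hq (Multiplicative.ofAdd v)
    have := mem_pull W x
    rw [h, mem_pull, hx] at this
    exact this.symm
  have pull_mono : ∀ W W', W ≤ W' → pull W ≤ pull W' := fun W W' h x hx => by
    have := (mem_pull W ⟨x, pull_le W hx⟩).1 hx
    exact (mem_pull W' ⟨x, pull_le W hx⟩).2 (h this)
  have pull_top : pull ⊤ = R :=
    le_antisymm (pull_le _) fun x hx => (mem_pull ⊤ ⟨x, hx⟩).2 Submodule.mem_top
  let U : Submodule (ZMod p) V :=
    AddSubgroup.toZModSubmodule p (Subgroup.toAddSubgroup' ((T.subgroupOf R).map q))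
  have memU : ∀ v, v ∈ U ↔ ∃ x : R, (x : G) ∈ T ∧ (q x).toAdd = v := fun v => Iff.rfl
  have pullU : pull U = T := by
    refine le_antisymm (fun x hx => ?_) fun x hx =>
      (mem_pull U ⟨x, hlt.le hx⟩).2 ((memU _).2 ⟨_, hx, rfl⟩)
    obtain ⟨y, hy, hyx⟩ := (memU _).1 ((mem_pull U ⟨x, pull_le U hx⟩).1 hx)
    have h1 : (q (y⁻¹ * ⟨x, pull_le U hx⟩)).toAdd = 0 := by
      rw [map_mul, map_inv, toAdd_mul, toAdd_inv, hyx, neg_add_cancel]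
    have h2 := hST ((q_eq _).1 h1)
    exact (T.mul_mem_cancel_left (inv_mem hy)).1 h2
  have card_eq : ∀ W : Submodule (ZMod p) V, S.relIndex (pull W) =
      p ^ Module.finrank (ZMod p) W := fun W => by
    rw [card_pull, Module.natCard_eq_pow_finrank (K := ZMod p), Nat.card_zmod]
  have pinj := Nat.pow_right_injective hp.out.two_le
  have hU1 : Module.finrank (ZMod p) U = 1 := pinj (by
    change p ^ _ = p ^ 1
    rw [← card_eq, pullU, hS, pow_one])
  have htop : S.relIndex R = p ^ Module.finrank (ZMod p) V := by
    rw [← finrank_top (ZMod p) V, ← card_eq, pull_top]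
  have hUinv : ∀ g, ∀ t ∈ U, ρ g t ∈ U := by
    rintro g _ ⟨x, hx, rfl⟩
    exact (memU _).2 ⟨MulAut.conjNormal g x, hTn.conj_mem _ hx g, (hρ g x).symm⟩
  have hRtriv : ∀ s ∈ R, ρ s = 1 := fun s hs => by
    ext v
    obtain ⟨x, hx⟩ := hq (Multiplicative.ofAdd v)
    have hv : v = (q x).toAdd := by rw [hx]; rfl
    have hx' : q (MulAut.conjNormal s x) = q x := by
      have h := (q_eq (MulAut.conjNormal s x * x⁻¹)).2 (hcomm s hs x x.2)
      rw [map_mul, map_inv] at h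
      exact mul_inv_eq_one.1 h
    rw [hv, hρ, hx']
    rfl
  obtain ⟨N, hN, hc⟩ := exists_isCompl_of_finrank_eq_one ρ R hRtriv hR U hU1
    (fun e => hlt.ne (by rw [← pullU, e, pull_top])) hUinv
    (fun W hW hUW => by
      rcases hmin (pull W) (pull_normal W hW) (pullU ▸ pull_mono _ _ hUW) (pull_le W) with e | e
      · exact Or.inl (pull_inj _ _ (e.trans pullU.symm))
      · exact Or.inr (pull_inj _ _ (e.trans pull_top.symm)))
    (fun h2 => hT (by
      have := relIndex_mul_relIndex S T R hST hlt.le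
      rw [htop, hS, h2, pow_two] at this
      exact Nat.eq_of_mul_eq_mul_left hp.out.pos this))
  refine ⟨pull N, pull_normal N hN, pull_le N, ?_⟩
  have h1 := relIndex_mul_relIndex S (pull N) R (le_pull N) (pull_le N)
  rw [card_eq, htop, ← Submodule.finrank_add_eq_of_isCompl hc, hU1, pow_succ] at h1
  exact Nat.eq_of_mul_eq_mul_left (pow_pos hp.out.pos _) h1

end

/-- in a p-solvable minimal non-p-supersolvable group, a proper subgroup of
`G^{𝔘_p}` that is c-embedded in `G` with respect to `P` lies in `Z(P)`. -/
theorem stmt3 (p : ℕ) (hp : p.Prime) (G : Type*) [Group G] [Finite G]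
    (hsolv : IsPSolvable p G) (hns : ¬ IsPSupersolvable p G)
    (hmin : ∀ H : Subgroup G, H < ⊤ → IsPSupersolvable p H)
    (R : Subgroup G) (hR : IsPSupersolvableResidual p R)
    (P : Sylow p G) (hRP : R ≤ P)
    (H : Subgroup G) (hH : H < R) (hc : IsCEmbedded H (P : Subgroup G)) :
    H ≤ centerOf (P : Subgroup G) := by
  obtain ⟨B, hHB, hB⟩ := hc
  rcases eq_top_or_exists_le_coatom B with rfl | ⟨M, hM, hBM⟩
  · simpa using hB
  exfalso
  have : Fact p.Prime := ⟨hp⟩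
  obtain ⟨hRn, hRq, hRmin⟩ := hR
  have hRp : IsPGroup p R := P.isPGroup'.to_le hRP
  have hHM : ∀ g : G, ∃ h ∈ H, ∃ m ∈ M, g = h * m := fun g => by
    obtain ⟨h, hh, b, hb, e⟩ := hHB g
    exact ⟨h, hh, b, hBM hb, e⟩
  have hno : ∀ N : Subgroup G, N.Normal → N ≤ R → N.relIndex R ≠ p := fun N hN hNR h => by
    have := hRmin N hN (quotientIsPSupersolvable_of_relIndex_eq_prime hNR hRq h)
    rw [relIndex_eq_one.2 this] at h
    exact hp.one_lt.ne h
  -- the Frattini subgroup of `R`, as a subgroup of `G`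
  set F : Subgroup G := (frattini R).map R.subtype with hF
  have hFR : F ≤ R := map_subtype_le _
  have hFn : F.Normal := inferInstance
  have hFgen : ∀ X ≤ R, R ≤ X ⊔ F → X = R := by
    intro X hX hle
    have h1 : X.subgroupOf R ⊔ frattini R = ⊤ := by
      apply map_injective R.subtype_injective
      rw [Subgroup.map_sup, ← hF, subgroupOf_map_subtype, inf_eq_left.2 hX, ← MonoidHom.range_eq_map,
        range_subtype]
      exact le_antisymm (sup_le hX hFR) hle
    exact le_antisymm hX (subgroupOf_eq_top.1 (frattini_nongenerating h1))
  have hFpow : ∀ x ∈ R, x ^ p ∈ F := fun x hx =>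
    ⟨_, hRp.pow_mem_frattini ⟨x, hx⟩, rfl⟩
  have hFcomm : ∀ x ∈ R, ∀ y ∈ R, x * y * x⁻¹ * y⁻¹ ∈ F := fun x hx y hy =>
    ⟨_, hRp.commutator_mem_frattini ⟨x, hx⟩ ⟨y, hy⟩, rfl⟩
  have hnorm : ∀ X : Subgroup G, F ≤ X → X ≤ R → (∀ m ∈ M, ∀ x ∈ X, m * x * m⁻¹ ∈ X) →
      X.Normal := by
    intro X hFX hXR hXM
    refine ⟨fun x hx g => ?_⟩
    obtain ⟨h, hh, m, hm, rfl⟩ := hHM g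
    have h1 := hXM m hm x hx
    have h2 := mul_mem (hFX (hFcomm h (hH.le hh) _ (hXR h1))) h1
    convert h2 using 1
    group
  have hRM : ¬ R ≤ M := fun h => hM.1 (eq_top_iff.2 fun g _ => by
    obtain ⟨h', hh, m, hm, rfl⟩ := hHM g
    exact mul_mem (h (hH.le hh)) hm)
  have hsupM : ∀ X : Subgroup G, ¬ X ≤ M → M ⊔ X = ⊤ := fun X hX =>
    hM.2 _ (left_lt_sup.2 hX)
  have hdecomp : ∀ X : Subgroup G, X.Normal → X ≤ R → ¬ X ≤ M → R ≤ R ⊓ M ⊔ X := by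
    intro X _ hXR hX r hr
    obtain ⟨m, hm, x, hx, rfl⟩ := mem_sup_of_normal_right.1
      (show r ∈ M ⊔ X by rw [hsupM X hX]; exact mem_top r)
    exact mul_mem_sup ⟨(R.mul_mem_cancel_right (hXR hx)).1 hr, hm⟩ hx
  have hFM : F ≤ M := by
    by_contra h
    exact hRM (inf_eq_left.1 (hFgen _ inf_le_left (hdecomp F hFn hFR h)))
  set T := R ⊓ M with hT
  have hFT : F ≤ T := le_inf hFR hFM
  have hTn : T.Normal := hnorm T hFT inf_le_left fun m hm x hx =>
    ⟨hRn.conj_mem x hx.1 m, M.mul_mem (M.mul_mem hm hx.2) (M.inv_mem hm)⟩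
  have hTR : IsChiefFactor G T R := by
    refine ⟨hTn, hRn, lt_of_le_of_ne inf_le_left fun e => hRM (inf_eq_left.1 e),
      fun X hX hTX hXR => ?_⟩
    by_cases hXM : X ≤ M
    · exact Or.inl (le_antisymm (le_inf hXR hXM) hTX)
    · exact Or.inr (le_antisymm hXR ((hdecomp X hX hXR hXM).trans (sup_le hTX le_rfl)))
  have hHT : R ≤ H ⊔ T := fun r hr => by
    obtain ⟨h, hh, m, hm, rfl⟩ := hHM r
    exact mul_mem_sup hh ⟨(R.mul_mem_cancel_left (hH.le hh)).1 hr, hm⟩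
  have hFltT : F < T := lt_of_le_of_ne hFT fun e => hH.ne (hFgen H hH.le (e ▸ hHT))
  obtain ⟨S, hFS, hST⟩ := exists_isChiefFactor_below hFn hTn hFltT
  have hSn := hST.1
  have hSlt := hST.2.2.1
  have hTM : T ≤ M := inf_le_right
  have hST' : IsChiefFactor M (S.subgroupOf M) (T.subgroupOf M) := by
    refine ⟨inferInstance, inferInstance, ?_, fun X hX h1 h2 => ?_⟩
    · refine lt_of_le_of_ne (comap_mono hSlt.le) fun e => hSlt.ne ?_
      have := congrArg (map M.subtype) e
      rwa [subgroupOf_map_subtype, subgroupOf_map_subtype, inf_eq_left.2 (hSlt.le.trans hTM),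
        inf_eq_left.2 hTM] at this
    · have h1' := map_mono (f := M.subtype) h1
      have h2' := map_mono (f := M.subtype) h2
      rw [subgroupOf_map_subtype, inf_eq_left.2 (hSlt.le.trans hTM)] at h1'
      rw [subgroupOf_map_subtype, inf_eq_left.2 hTM] at h2'
      have hXn : (X.map M.subtype).Normal := by
        refine hnorm _ (hFS.trans h1') (h2'.trans inf_le_left) ?_
        rintro m hm _ ⟨x, hx, rfl⟩
        exact ⟨_, hX.conj_mem x hx ⟨m, hm⟩, rfl⟩
      have hXe : (X.map M.subtype).subgroupOf M = X :=
        comap_map_eq_self_of_injective M.subtype_injective X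
      exact (hST.2.2.2 _ hXn h1' h2').imp (fun e => by rw [← hXe, e]) (fun e => by rw [← hXe, e])
  have hSidx : S.relIndex T = p := by
    rw [← relIndex_subgroupOf hTM]
    refine (hmin M hM.lt_top).relIndex_eq hST' ?_
    rw [relIndex_subgroupOf hTM]
    have hTp : IsPGroup p T := hRp.to_le inf_le_left
    obtain ⟨n, hn⟩ := hTp.index (S.subgroupOf T)
    change S.relIndex T = _ at hn
    rw [hn]
    refine dvd_pow_self p fun h0 => ?_
    rw [h0, pow_zero, relIndex_eq_one] at hn
    exact hSlt.not_ge hn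
  obtain ⟨N, hN, hNR, hNi⟩ := exists_normal_relIndex_eq_prime hSlt.le hTR
    (fun x hx y hy => hFS (hFcomm x hx y hy)) (fun x hx => hFS (hFpow x hx)) hSidx
    (hno T hTn inf_le_left) hRq
  exact hno N hN hNR hNi
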